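/- Let δ: F_q[t] → {0,1} be the indicator of 0. For any Q ≥ 1 and n ∈ F_q[t], δ(n) = q^{-2Q} Σ_{r monic, |r| ≤ q^Q} Σ*_{|a|<|r|} ψ(an/r) · h(r/t^Q, n/t^{2Q}), where Σ* restricts to a coprime to r, and h(x,y) = |x|^{-1} if |y| < |x| and 0 otherwise. -/

import Mathlib

/-!
Common setup: `K_∞ = 𝔽_q((1/t))` is modeled as `LaurentSeries Fq` in the variable `X = 1/t`,
so that an element `Σ_{i ≤ N} a_i t^i` of `K_∞` corresponds to the Hahn series
`Σ_{n ≥ -N} a_{-n} X^n`.  The degree in `t` is the negative of the Hahn-series order,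
the absolute value is `|α| = q^{deg_t α}`, and the standard additive character is
`ψ(α) = e_q(coefficient of t^{-1}) = e_q(coefficient of X^1)`.
-/

open scoped BigOperators Classical
noncomputable section



namespace FF

variable {Fq : Type*} [Field Fq] [Fintype Fq]

/-- The element `t = X⁻¹` of `K_∞`. -/
def tK : LaurentSeries Fq := HahnSeries.single (-1 : ℤ) 1

/-- Degree in `t` of a Laurent series (degree of `0` is `0` by convention). -/
def tdeg (α : LaurentSeries Fq) : ℤ := -α.order

/-- The absolute value `|α| = q^{deg_t α}` on `K_∞`, with `|0| = 0`. -/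
def absv (α : LaurentSeries Fq) : ℝ :=
  if α = 0 then 0 else (Fintype.card Fq : ℝ) ^ (-α.order)

/-- The embedding `𝔽_q[t] → K_∞`. -/
def toK (p : Polynomial Fq) : LaurentSeries Fq := Polynomial.eval₂ HahnSeries.C tK p

/-- The standard additive character `ψ` of `K_∞` attached to a character `e` of `𝔽_q`. -/
def psi (e : AddChar Fq ℂ) (α : LaurentSeries Fq) : ℂ := e (α.coeff 1)

/-- The polynomial `Σ_{i<N} c_i t^i` attached to a coefficient tuple. -/
def polyOf {N : ℕ} (c : Fin N → Fq) : Polynomial Fq :=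
  ∑ i : Fin N, Polynomial.C (c i) * Polynomial.X ^ (i : ℕ)

/-- Absolute value of a polynomial: `|p| = q^{deg p}`, `|0| = 0`. -/
def absP (p : Polynomial Fq) : ℝ :=
  if p = 0 then 0 else (Fintype.card Fq : ℝ) ^ p.natDegree

/-- The part `((γ))` of `γ` supported in strictly negative `t`-degrees. -/
def fracPart (γ : LaurentSeries Fq) : LaurentSeries Fq where
  coeff n := if 1 ≤ n then γ.coeff n else 0
  isPWO_support' := γ.isPWO_support'.mono (fun n hn => by
    by_cases h : (1 : ℤ) ≤ n <;> simp_all [Function.support])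

/-- A canonical choice of inverse of `x` modulo `c` (junk value `0` if not coprime). -/
def modInv (x c : Polynomial Fq) : Polynomial Fq :=
  if h : IsCoprime x c then h.choose else 0

/-- Riemann sums approximating the Haar integral (normalized by `μ(𝕋) = 1`) of `w`
over the ball `{|α| < q^Y}`, at resolution `M`: the ball is partitioned into `q^M`
sub-balls of measure `q^{Y-M}` with representatives `Σ_{0 ≤ j < M} c_j t^{Y-1-j}`. -/
def ballSum (Y : ℤ) (M : ℕ) (w : LaurentSeries Fq → ℂ) : ℂ :=
  ((Fintype.card Fq : ℂ) ^ Y * ((Fintype.card Fq : ℂ) ^ M)⁻¹) *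
    ∑ c : Fin M → Fq, w (∑ j : Fin M, HahnSeries.single ((1 : ℤ) - Y + (j : ℕ)) (c j))

/-- Riemann sums approximating the Haar integral of `w` over `𝕋^d` at resolution `M`. -/
def cubeSum (d M : ℕ) (w : (Fin d → LaurentSeries Fq) → ℂ) : ℂ :=
  (((Fintype.card Fq : ℂ) ^ (d * M))⁻¹) *
    ∑ c : Fin d → Fin M → Fq,
      w (fun i => ∑ j : Fin M, HahnSeries.single (((j : ℕ) : ℤ) + 1) (c i j))

end FF

namespace FF
variable {Fq : Type*} [Field Fq] [Fintype Fq]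

/-- The function `h(x,y) = |x|⁻¹` if `|y| < |x|`, and `0` otherwise. -/
def hFun (x y : LaurentSeries Fq) : ℝ := if absv y < absv x then (absv x)⁻¹ else 0

end FF

namespace FF

open Polynomial

variable {Fq : Type*} [Field Fq]

lemma toK_eq_eval₂RingHom (p : Fq[X]) :
    toK p = eval₂RingHom (HahnSeries.C : Fq →+* LaurentSeries Fq) tK p := rfl

@[simp] lemma toK_zero : toK (0 : Fq[X]) = 0 := by simp [toK]

@[simp] lemma toK_add (p r : Fq[X]) : toK (p + r) = toK p + toK r := by
  simp [toK_eq_eval₂RingHom]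

@[simp] lemma toK_mul (p r : Fq[X]) : toK (p * r) = toK p * toK r := by
  simp only [toK_eq_eval₂RingHom, map_mul]

@[simp] lemma toK_C (a : Fq) : toK (C a) = HahnSeries.C a := by simp [toK]

lemma toK_C_mul_X_pow (a : Fq) (i : ℕ) :
    toK (C a * X ^ i) = HahnSeries.single (-(i : ℤ)) a := by
  simp [toK, tK, HahnSeries.single_pow, HahnSeries.C_apply, HahnSeries.single_mul_single]

lemma coeff_toK (p : Fq[X]) (k : ℤ) :
    (toK p).coeff k = if k ≤ 0 then p.coeff (-k).toNat else 0 := by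
  induction p using Polynomial.induction_on' with
  | add p r hp hr =>
    rw [toK_add, HahnSeries.coeff_add, hp, hr]
    split_ifs <;> simp
  | monomial i a =>
    rw [← C_mul_X_pow_eq_monomial, toK_C_mul_X_pow, HahnSeries.coeff_single, coeff_C_mul_X_pow]
    split_ifs <;> first | rfl | omega

lemma toK_ne_zero {p : Fq[X]} (hp : p ≠ 0) : toK p ≠ 0 := by
  intro h
  have := coeff_toK p (-(p.natDegree : ℤ))
  rw [h] at this
  simp [eq_comm (a := (0 : Fq))] at this
  exact hp this

lemma order_toK {p : Fq[X]} (hp : p ≠ 0) : (toK p).order = -(p.natDegree : ℤ) := by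
  apply le_antisymm
  · apply HahnSeries.order_le_of_coeff_ne_zero
    simp [coeff_toK, hp]
  · rw [HahnSeries.le_order_iff_forall (toK_ne_zero hp)]
    intro j hj
    rw [coeff_toK, if_pos (by omega), coeff_eq_zero_of_natDegree_lt (by omega)]

lemma order_div {x y : LaurentSeries Fq} (hx : x ≠ 0) (hy : y ≠ 0) :
    (x / y).order = x.order - y.order := by
  have h := HahnSeries.order_mul (div_ne_zero hx hy) hy
  rw [div_mul_cancel₀ _ hy] at h
  omega

lemma psi_toK (e : AddChar Fq ℂ) (p : Fq[X]) : psi e (toK p) = 1 := by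
  simp [psi, coeff_toK]

lemma psi_add (e : AddChar Fq ℂ) (x y : LaurentSeries Fq) :
    psi e (x + y) = psi e x * psi e y := by
  simp [psi, AddChar.map_add_eq_mul]

lemma tK_ne_zero : (tK : LaurentSeries Fq) ≠ 0 := by simp [tK]

section Absolute

variable [Fintype Fq]

lemma one_lt_card : (1 : ℝ) < Fintype.card Fq := by
  exact_mod_cast Fintype.one_lt_card

lemma absv_toK_div_tK_pow {p : Fq[X]} (hp : p ≠ 0) (k : ℕ) :
    absv (toK p / tK ^ k) = (Fintype.card Fq : ℝ) ^ ((p.natDegree : ℤ) - k) := by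
  rw [absv, if_neg (div_ne_zero (toK_ne_zero hp) (pow_ne_zero _ tK_ne_zero)),
    order_div (toK_ne_zero hp) (pow_ne_zero _ tK_ne_zero), order_toK hp, HahnSeries.order_pow,
    tK, HahnSeries.order_single one_ne_zero]
  congr 1
  simp
  ring

lemma hFun_toK {r : Fq[X]} (hr : r ≠ 0) (Q : ℕ) (n : Fq[X]) :
    hFun (toK r / tK ^ Q) (toK n / tK ^ (2 * Q)) =
      if n.degree < (r.natDegree + Q : ℕ) then
        (Fintype.card Fq : ℝ) ^ Q / (Fintype.card Fq : ℝ) ^ r.natDegree else 0 := by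
  have hq := one_lt_card (Fq := Fq)
  have hval : (absv (toK r / tK ^ Q))⁻¹ =
      (Fintype.card Fq : ℝ) ^ Q / (Fintype.card Fq : ℝ) ^ r.natDegree := by
    rw [absv_toK_div_tK_pow hr, zpow_sub₀ (by positivity), inv_div]
    simp
  have hcond : absv (toK n / tK ^ (2 * Q)) < absv (toK r / tK ^ Q) ↔
      n.degree < (r.natDegree + Q : ℕ) := by
    rw [absv_toK_div_tK_pow hr]
    rcases eq_or_ne n 0 with rfl | hn
    · have : (0 : ℝ) < (Fintype.card Fq : ℝ) ^ ((r.natDegree : ℤ) - Q) := by positivity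
      simpa [absv, WithBot.bot_lt_iff_ne_bot] using this
    · rw [absv_toK_div_tK_pow hn, zpow_lt_zpow_iff_right₀ hq, degree_eq_natDegree hn,
        Nat.cast_lt]
      push_cast
      omega
  rw [hFun, hval]
  exact if_congr hcond rfl rfl

end Absolute

section Enumeration

lemma coeff_polyOf {N : ℕ} (c : Fin N → Fq) (i : ℕ) :
    (polyOf c).coeff i = if h : i < N then c ⟨i, h⟩ else 0 := by
  simp only [polyOf, finsetSum_coeff, coeff_C_mul_X_pow]
  split_ifs with h
  · rw [Finset.sum_eq_single ⟨i, h⟩] <;> grind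
  · exact Finset.sum_eq_zero fun j _ ↦ if_neg (by have := j.2; omega)

lemma polyOf_injective (N : ℕ) : Function.Injective (polyOf : (Fin N → Fq) → Fq[X]) := by
  intro c d h
  ext i
  have := congrArg (fun p ↦ p.coeff i) h
  simpa [coeff_polyOf] using this

variable [Fintype Fq]

variable (Fq) in
/-- The polynomials of degree less than `N`. -/
def polysLT (N : ℕ) : Finset Fq[X] := Finset.univ.image (polyOf : (Fin N → Fq) → Fq[X])

@[simp] lemma mem_polysLT {N : ℕ} {p : Fq[X]} : p ∈ polysLT Fq N ↔ p.degree < N := by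
  simp only [polysLT, Finset.mem_image, Finset.mem_univ, true_and, degree_lt_iff_coeff_zero]
  constructor
  · rintro ⟨c, rfl⟩ m hm
    simp [coeff_polyOf, Nat.not_lt.2 hm]
  · intro h
    refine ⟨fun i ↦ p.coeff i, ?_⟩
    ext m
    rw [coeff_polyOf]
    split_ifs with hm
    · rfl
    · exact (h m (not_lt.1 hm)).symm

lemma card_polysLT (N : ℕ) : (polysLT Fq N).card = Fintype.card Fq ^ N := by
  rw [polysLT, Finset.card_image_of_injective _ (polyOf_injective N)]
  simp

lemma sum_polyOf {M : Type*} [AddCommMonoid M] (N : ℕ) (f : Fq[X] → M) :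
    ∑ c : Fin N → Fq, f (polyOf c) = ∑ p ∈ polysLT Fq N, f p := by
  rw [polysLT, Finset.sum_image fun _ _ _ _ h ↦ polyOf_injective N h]

variable (Fq) in
/-- The monic polynomials of degree `k`. -/
def monicsOfDegree (k : ℕ) : Finset Fq[X] := (polysLT Fq k).image (X ^ k + ·)

@[simp] lemma mem_monicsOfDegree {k : ℕ} {p : Fq[X]} :
    p ∈ monicsOfDegree Fq k ↔ p.Monic ∧ p.natDegree = k := by
  simp only [monicsOfDegree, Finset.mem_image, mem_polysLT]
  constructor
  · rintro ⟨r, hr, rfl⟩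
    have hm := monic_X_pow_add hr
    refine ⟨hm, natDegree_eq_of_degree_eq_some ?_⟩
    rw [degree_add_eq_left_of_degree_lt] <;> simp [hr]
  · rintro ⟨hp, rfl⟩
    refine ⟨p - X ^ p.natDegree, ?_, by simp⟩
    rw [← degree_eq_natDegree hp.ne_zero]
    apply degree_sub_lt_left <;> simp [hp.ne_zero, degree_eq_natDegree, hp]

lemma card_monicsOfDegree (k : ℕ) : (monicsOfDegree Fq k).card = Fintype.card Fq ^ k := by
  rw [monicsOfDegree, Finset.card_image_of_injective _ (add_right_injective _), card_polysLT]

/-- The residues of degree less than `k` coprime to `r`. -/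
def coprimeLT (k : ℕ) (r : Fq[X]) : Finset Fq[X] := (polysLT Fq k).filter (IsCoprime · r)

@[simp] lemma mem_coprimeLT {k : ℕ} {r a : Fq[X]} :
    a ∈ coprimeLT k r ↔ a.degree < k ∧ IsCoprime a r := by
  simp [coprimeLT]

lemma sum_monic_coprime {M : Type*} [AddCommMonoid M] (Q : ℕ) (f : Fq[X] → Fq[X] → M) :
    ∑ r ∈ polysLT Fq (Q + 1), ∑ a ∈ polysLT Fq (Q + 1),
        (if r.Monic ∧ a.degree < r.degree ∧ IsCoprime a r then f r a else 0) =
      ∑ j ∈ Finset.range (Q + 1), ∑ r ∈ monicsOfDegree Fq j, ∑ a ∈ coprimeLT j r, f r a := by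
  rw [← Finset.sum_fiberwise_of_maps_to (g := natDegree) (t := Finset.range (Q + 1))]
  swap
  · intro r hr
    rw [mem_polysLT] at hr
    rw [Finset.mem_range]
    obtain rfl | hr0 := eq_or_ne r 0
    · simp
    · exact (natDegree_lt_iff_degree_lt hr0).2 hr
  refine Finset.sum_congr rfl fun j hj ↦ ?_
  rw [Finset.mem_range] at hj
  symm
  apply Finset.sum_subset_zero_on_sdiff
  · intro r hr
    obtain ⟨hr, rfl⟩ := mem_monicsOfDegree.1 hr
    simp only [Finset.mem_filter, mem_polysLT, and_true]
    exact degree_le_natDegree.trans_lt (by exact_mod_cast hj)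
  · intro r hr
    refine Finset.sum_eq_zero fun a _ ↦ if_neg fun h ↦ ?_
    simp [h.1] at hr
    tauto
  · intro r hr
    obtain ⟨hm, rfl⟩ := mem_monicsOfDegree.1 hr
    rw [← Finset.sum_filter]
    refine Finset.sum_congr ?_ fun _ _ ↦ rfl
    ext a
    simp only [mem_coprimeLT, Finset.mem_filter, mem_polysLT, hm, true_and,
      degree_eq_natDegree hm.ne_zero, iff_and_self, and_imp]
    intro h _
    exact h.trans (by exact_mod_cast hj)

end Enumeration

lemma exists_monic_gcd {r : Fq[X]} (hr : r ≠ 0) (a : Fq[X]) :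
    ∃ d r' a' : Fq[X], d.Monic ∧ r = d * r' ∧ a = d * a' ∧ IsCoprime a' r' := by
  obtain ⟨g, a', r', rfl, rfl, h⟩ : ∃ g a' r' : Fq[X], a = g * a' ∧ r = g * r' ∧
      IsCoprime a' r' := by
    let := EuclideanDomain.gcdMonoid Fq[X]
    have h0 := gcd_ne_zero_of_right (a := a) hr
    exact ⟨gcd a r, a / gcd a r, r / gcd a r,
      (EuclideanDomain.mul_div_cancel' h0 (gcd_dvd_left _ _)).symm,
      (EuclideanDomain.mul_div_cancel' h0 (gcd_dvd_right _ _)).symm,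
      isCoprime_div_gcd_div_gcd hr⟩
  have hg : g ≠ 0 := left_ne_zero_of_mul hr
  have hu : IsUnit (C g.leadingCoeff) := by simp [hg]
  have hC : C g.leadingCoeff⁻¹ * C g.leadingCoeff = 1 := by
    rw [← C_mul, inv_mul_cancel₀ (by simpa), C_1]
  refine ⟨g * C g.leadingCoeff⁻¹, C g.leadingCoeff * r', C g.leadingCoeff * a',
    monic_mul_leadingCoeff_inv hg, ?_, ?_,
    (isCoprime_mul_unit_left hu _ _).2 h⟩ <;>
  first
  | linear_combination (-g * r') * hC
  | linear_combination (-g * a') * hC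

lemma dvd_of_mul_eq_mul_of_isCoprime {R : Type*} [CommRing R] {d d' r r' a a' : R}
    (h : IsCoprime a r) (hr : d * r = d' * r') (ha : d * a = d' * a') : d' ∣ d := by
  obtain ⟨u, v, huv⟩ := h
  exact ⟨u * a' + v * r', by linear_combination (-d) * huv + u * ha + v * hr⟩

lemma exists_psi_ne_one {e : AddChar Fq ℂ} (he : e ≠ 1) {r n : Fq[X]} (hr : r.Monic)
    (h : ¬ r ∣ n) :
    ∃ a : Fq[X], a.degree < r.natDegree ∧ psi e (toK a * toK n / toK r) ≠ 1 := by
  obtain ⟨v, hv⟩ := AddChar.ne_one_iff.1 he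
  set s := n %ₘ r with hs
  have hs0 : s ≠ 0 := fun h0 ↦ h ((modByMonic_eq_zero_iff_dvd hr).1 h0)
  have hdeg : s.natDegree < r.natDegree :=
    natDegree_lt_natDegree hs0 (degree_modByMonic_lt n hr)
  have hr0 := toK_ne_zero hr.ne_zero
  set b : Fq[X] := X ^ (r.natDegree - 1 - s.natDegree) with hb
  have hb0 : b ≠ 0 := by simp [hb]
  set α := toK (b * s) / toK r with hα
  have hα0 : α ≠ 0 := div_ne_zero (toK_ne_zero (mul_ne_zero hb0 hs0)) hr0
  have hα1 : α.coeff 1 ≠ 0 := by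
    have ho : α.order = 1 := by
      rw [order_div (toK_ne_zero (mul_ne_zero hb0 hs0)) hr0, order_toK hr.ne_zero,
        order_toK (mul_ne_zero hb0 hs0), natDegree_mul hb0 hs0, hb, natDegree_X_pow]
      omega
    rw [← ho]
    exact mt HahnSeries.coeff_order_eq_zero.1 hα0
  refine ⟨C (v / α.coeff 1) * b, ?_, ?_⟩
  · rw [hb]
    refine (degree_C_mul_X_pow_le _ _).trans_lt ?_
    exact_mod_cast (by omega : r.natDegree - 1 - s.natDegree < r.natDegree)
  · have hdecomp : toK (C (v / α.coeff 1) * b) * toK n / toK r =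
        toK (C (v / α.coeff 1) * b * (n /ₘ r)) + HahnSeries.C (v / α.coeff 1) * α := by
      generalize v / α.coeff 1 = c
      conv_lhs => rw [← modByMonic_add_div n r, ← hs]
      simp only [toK_mul, toK_add, toK_C, hα]
      field_simp
      ring
    rw [hdecomp, psi_add, psi_toK, one_mul, psi, HahnSeries.C_mul_eq_smul,
      HahnSeries.coeff_smul, smul_eq_mul, div_mul_cancel₀ _ hα1]
    exact hv

variable [Fintype Fq]

lemma sum_eq_sum_gcd {M : Type*} [AddCommMonoid M] (k : ℕ) (f : Fq[X] → Fq[X] → M)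
    (hf : ∀ d r a, d ≠ 0 → f (d * r) (d * a) = f r a) :
    ∑ r ∈ monicsOfDegree Fq k, ∑ a ∈ polysLT Fq k, f r a =
      ∑ j ∈ Finset.range (k + 1), Fintype.card Fq ^ (k - j) •
        ∑ r ∈ monicsOfDegree Fq j, ∑ a ∈ coprimeLT j r, f r a := by
  simp only [← card_monicsOfDegree, ← Finset.sum_const, Finset.sum_sigma']
  symm
  refine Finset.sum_bij
    (fun x _ ↦ (⟨x.2.1 * x.2.2.1, x.2.1 * x.2.2.2⟩ : (_ : Fq[X]) × Fq[X])) ?_ ?_ ?_ ?_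
  · rintro ⟨j, d, r, a⟩ h
    simp only [Finset.mem_sigma, Finset.mem_range, mem_monicsOfDegree, mem_coprimeLT,
      mem_polysLT] at h ⊢
    obtain ⟨hj, ⟨hd, hd'⟩, ⟨hr, hr'⟩, ha, -⟩ := h
    refine ⟨⟨hd.mul hr, by rw [hd.natDegree_mul hr]; omega⟩, ?_⟩
    rw [degree_mul, degree_eq_natDegree hd.ne_zero, hd']
    obtain rfl | ha0 := eq_or_ne a 0
    · simp
    · rw [degree_eq_natDegree ha0] at ha ⊢
      norm_cast at ha ⊢
      omega
  · rintro ⟨j, d, r, a⟩ h ⟨j', d', r', a'⟩ h' heq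
    simp only [Finset.mem_sigma, Finset.mem_range, mem_monicsOfDegree, mem_coprimeLT] at h h'
    obtain ⟨hj, ⟨hd, -⟩, ⟨hr, hrj⟩, -, hc⟩ := h
    obtain ⟨hj', ⟨hd', -⟩, ⟨hr', hrj'⟩, -, hc'⟩ := h'
    simp only [Sigma.mk.injEq, heq_eq_eq] at heq
    obtain ⟨h1, h2⟩ := heq
    obtain rfl : d = d' := eq_of_monic_of_associated hd hd' <| associated_of_dvd_dvd
      (dvd_of_mul_eq_mul_of_isCoprime hc' h1.symm h2.symm)
      (dvd_of_mul_eq_mul_of_isCoprime hc h1 h2)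
    obtain rfl := mul_left_cancel₀ hd.ne_zero h1
    obtain rfl := mul_left_cancel₀ hd.ne_zero h2
    obtain rfl := hrj.symm.trans hrj'
    rfl
  · rintro ⟨r, a⟩ h
    simp only [Finset.mem_sigma, mem_monicsOfDegree, mem_polysLT] at h
    obtain ⟨⟨hr, rfl⟩, ha⟩ := h
    obtain ⟨d, r', a', hd, rfl, rfl, hc⟩ := exists_monic_gcd hr.ne_zero a
    have hr' := hd.of_mul_monic_left hr
    have hdeg := hd.natDegree_mul hr'
    refine ⟨⟨r'.natDegree, d, r', a'⟩, ?_, rfl⟩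
    simp only [Finset.mem_sigma, Finset.mem_range, mem_monicsOfDegree, mem_coprimeLT]
    refine ⟨by omega, ⟨hd, by omega⟩, ⟨hr', trivial⟩, ?_, hc⟩
    obtain rfl | ha0 := eq_or_ne a' 0
    · simp
    · rw [degree_mul, degree_eq_natDegree hd.ne_zero, hdeg, degree_eq_natDegree ha0] at ha
      rw [degree_eq_natDegree ha0]
      norm_cast at ha ⊢
      omega
  · rintro ⟨j, d, r, a⟩ h
    simp only [Finset.mem_sigma, mem_monicsOfDegree] at h
    exact (hf _ _ _ h.2.1.1.ne_zero).symm

lemma sum_psi {e : AddChar Fq ℂ} (he : e ≠ 1) {r : Fq[X]} (hr : r.Monic) (n : Fq[X]) :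
    ∑ a ∈ polysLT Fq r.natDegree, psi e (toK a * toK n / toK r) =
      if r ∣ n then (Fintype.card Fq : ℂ) ^ r.natDegree else 0 := by
  split_ifs with h
  · obtain ⟨m, rfl⟩ := h
    have (a : Fq[X]) : psi e (toK a * toK (r * m) / toK r) = 1 := by
      have : toK a * toK (r * m) / toK r = toK (a * m) := by
        have := toK_ne_zero hr.ne_zero
        simp only [toK_mul]
        field_simp
      rw [this, psi_toK]
    simp only [this, Finset.sum_const, card_polysLT, nsmul_eq_mul, mul_one, Nat.cast_pow]
  · obtain ⟨b, hb, hb1⟩ := exists_psi_ne_one he hr h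
    have key : ∑ a ∈ polysLT Fq r.natDegree, psi e (toK a * toK n / toK r) =
        psi e (toK b * toK n / toK r) *
          ∑ a ∈ polysLT Fq r.natDegree, psi e (toK a * toK n / toK r) := by
      rw [Finset.mul_sum]
      refine Finset.sum_nbij' (· - b) (· + b) ?_ ?_ (by simp) (by simp) ?_
      · intro a ha
        rw [mem_polysLT] at ha ⊢
        exact (degree_sub_le _ _).trans_lt (max_lt ha hb)
      · intro a ha
        rw [mem_polysLT] at ha ⊢
        exact (degree_add_le _ _).trans_lt (max_lt ha hb)
      · intro a _
        rw [← psi_add, ← add_div, ← add_mul, ← toK_add]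
        simp
    have : (psi e (toK b * toK n / toK r) - 1) *
        ∑ a ∈ polysLT Fq r.natDegree, psi e (toK a * toK n / toK r) = 0 := by
      linear_combination -key
    exact (mul_eq_zero.1 this).resolve_left (sub_ne_zero.2 hb1)

/-- The number of monic divisors of `n` of degree `k`. -/
def monicDivisorCount (n : Fq[X]) (k : ℕ) : ℕ := ((monicsOfDegree Fq k).filter (· ∣ n)).card

/-- The sum of the Ramanujan sums `Σ*_{|a| < |r|} ψ(an/r)` over the monic `r` of degree `j`. -/
def ramanujanSum (e : AddChar Fq ℂ) (n : Fq[X]) (j : ℕ) : ℂ :=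
  ∑ r ∈ monicsOfDegree Fq j, ∑ a ∈ coprimeLT j r, psi e (toK a * toK n / toK r)

lemma sum_ramanujanSum {e : AddChar Fq ℂ} (he : e ≠ 1) (n : Fq[X]) (k : ℕ) :
    ∑ j ∈ Finset.range (k + 1), ramanujanSum e n j / (Fintype.card Fq : ℂ) ^ j =
      monicDivisorCount n k := by
  have hq : (Fintype.card Fq : ℂ) ≠ 0 := by simp
  have h := sum_eq_sum_gcd k (fun r a ↦ psi e (toK a * toK n / toK r)) fun d r a hd ↦ by
    have := toK_ne_zero hd
    simp only [toK_mul]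
    rw [mul_assoc, mul_div_mul_left _ _ this]
  have h' : ∑ r ∈ monicsOfDegree Fq k, ∑ a ∈ polysLT Fq k, psi e (toK a * toK n / toK r) =
      (Fintype.card Fq : ℂ) ^ k * monicDivisorCount n k := by
    rw [monicDivisorCount, Finset.card_filter, Nat.cast_sum, Finset.mul_sum]
    refine Finset.sum_congr rfl fun r hr ↦ ?_
    obtain ⟨hm, rfl⟩ := mem_monicsOfDegree.1 hr
    rw [sum_psi he hm]
    split_ifs <;> simp
  rw [h'] at h
  apply mul_left_cancel₀ (pow_ne_zero k hq)
  rw [h, Finset.mul_sum]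
  refine Finset.sum_congr rfl fun j hj ↦ ?_
  rw [Finset.mem_range, Nat.lt_succ_iff] at hj
  rw [nsmul_eq_mul, Nat.cast_pow, pow_sub₀ _ hq hj, ramanujanSum]
  ring

lemma monicDivisorCount_zero (k : ℕ) :
    monicDivisorCount (0 : Fq[X]) k = Fintype.card Fq ^ k := by
  simp [monicDivisorCount, card_monicsOfDegree]

lemma monicDivisorCount_eq_zero {n : Fq[X]} (hn : n ≠ 0) {k : ℕ} (hk : n.natDegree < k) :
    monicDivisorCount n k = 0 := by
  rw [monicDivisorCount, Finset.card_eq_zero, Finset.filter_eq_empty_iff]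
  intro r hr h
  have := natDegree_le_of_dvd h hn
  have := (mem_monicsOfDegree.1 hr).2
  omega

lemma monicDivisorCount_le {n : Fq[X]} (hn : n ≠ 0) {k l : ℕ} (hkl : k + l = n.natDegree) :
    monicDivisorCount n k ≤ monicDivisorCount n l := by
  have key {r : Fq[X]} (hr : r.Monic) (h : r ∣ n) :
      ∃ s : Fq[X], s.Monic ∧ r * s = C n.leadingCoeff⁻¹ * n := by
    obtain ⟨m, rfl⟩ := h
    have hm := right_ne_zero_of_mul hn
    refine ⟨m * C m.leadingCoeff⁻¹, monic_mul_leadingCoeff_inv hm, ?_⟩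
    rw [leadingCoeff_mul, hr.leadingCoeff, one_mul]
    ring
  have hu : n.leadingCoeff⁻¹ ≠ 0 := by simpa
  choose! g hg hrg using fun r ↦ fun (h : r.Monic ∧ r ∣ n) ↦ key h.1 h.2
  refine Finset.card_le_card_of_injOn g ?_ ?_
  · intro r hr
    simp only [Finset.coe_filter, mem_monicsOfDegree, Set.mem_ofPred_eq] at hr ⊢
    obtain ⟨⟨hr, rfl⟩, hdvd⟩ := hr
    have hs := hg r ⟨hr, hdvd⟩
    have heq := hrg r ⟨hr, hdvd⟩
    have hdeg := congrArg natDegree heq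
    rw [hr.natDegree_mul hs, natDegree_C_mul hu] at hdeg
    refine ⟨⟨hs, by omega⟩, C n.leadingCoeff * r, ?_⟩
    have hC : C n.leadingCoeff * C n.leadingCoeff⁻¹ = 1 := by
      rw [← C_mul, mul_inv_cancel₀ (by simpa), C_1]
    linear_combination (-n) * hC - C n.leadingCoeff * heq
  · intro r hr r' hr' h
    simp only [Finset.coe_filter, mem_monicsOfDegree, Set.mem_ofPred_eq] at hr hr'
    have h1 := hrg r ⟨hr.1.1, hr.2⟩
    have h2 := hrg r' ⟨hr'.1.1, hr'.2⟩
    rw [← h2, h] at h1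
    exact mul_right_cancel₀ (hg r' ⟨hr'.1.1, hr'.2⟩).ne_zero h1

lemma monicDivisorCount_symm {n : Fq[X]} (hn : n ≠ 0) {k l : ℕ} (hkl : k + l = n.natDegree) :
    monicDivisorCount n k = monicDivisorCount n l :=
  (monicDivisorCount_le hn hkl).antisymm (monicDivisorCount_le hn (by omega))

lemma sum_ramanujanSum_ite {e : AddChar Fq ℂ} (he : e ≠ 1) (Q : ℕ) (n : Fq[X]) :
    ∑ j ∈ Finset.range (Q + 1),
        (if n.degree < (j + Q : ℕ) then ramanujanSum e n j / (Fintype.card Fq : ℂ) ^ j else 0) =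
      if n = 0 then (Fintype.card Fq : ℂ) ^ Q else 0 := by
  split_ifs with hn
  · subst hn
    simp only [degree_zero, WithBot.bot_lt_natCast, if_true, sum_ramanujanSum he,
      monicDivisorCount_zero, Nat.cast_pow]
  simp only [degree_eq_natDegree hn, Nat.cast_lt]
  rcases le_or_gt (2 * Q) n.natDegree with h2 | h2
  · refine Finset.sum_eq_zero fun j hj ↦ if_neg ?_
    rw [Finset.mem_range] at hj
    omega
  rcases lt_or_ge n.natDegree Q with h1 | h1
  · rw [Finset.sum_congr rfl fun j _ ↦ if_pos (by omega), sum_ramanujanSum he,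
      monicDivisorCount_eq_zero hn h1, Nat.cast_zero]
  · rw [← Finset.sum_range_add_sum_Ico _ (show n.natDegree - Q + 1 ≤ Q + 1 by omega),
      Finset.sum_eq_zero (s := Finset.range _)
        (fun j hj ↦ if_neg (by rw [Finset.mem_range] at hj; omega)),
      Finset.sum_congr rfl fun j hj ↦ if_pos (by rw [Finset.mem_Ico] at hj; omega), zero_add,
      Finset.sum_Ico_eq_sub _ (by omega), sum_ramanujanSum he, sum_ramanujanSum he,
      monicDivisorCount_symm hn (show Q + (n.natDegree - Q) = n.natDegree by omega), sub_self]

end FF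

open FF in
/-- expansion of the delta function.  For `Q ≥ 1` and `n ∈ 𝔽_q[t]`,
`δ(n) = q^{-2Q} Σ_{r monic, |r| ≤ q^Q} Σ*_{|a| < |r|} ψ(an/r) h(r/t^Q, n/t^{2Q})`,
where `Σ*` restricts to `a` coprime to `r`; polynomials `r` with `|r| ≤ q^Q`
(resp. `a` with `|a| < |r| ≤ q^Q`) are enumerated by coefficient tuples of length `Q+1`. -/
theorem delta_expansion {Fq : Type*} [Field Fq] [Fintype Fq]
    (e : AddChar Fq ℂ) (he : e ≠ 1) (Q : ℕ) (hQ : 1 ≤ Q) (n : Polynomial Fq) :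
    (if n = 0 then (1 : ℂ) else 0) =
      ((Fintype.card Fq : ℂ) ^ (2 * Q))⁻¹ *
        ∑ rc : Fin (Q + 1) → Fq, ∑ ac : Fin (Q + 1) → Fq,
          if (polyOf rc).Monic ∧ (polyOf ac).degree < (polyOf rc).degree ∧
              IsCoprime (polyOf ac) (polyOf rc) then
            psi e (toK (polyOf ac) * toK n / toK (polyOf rc)) *
              ((hFun (toK (polyOf rc) / tK ^ Q) (toK n / tK ^ (2 * Q)) : ℝ) : ℂ)
          else 0 := by
  have hq : (Fintype.card Fq : ℂ) ≠ 0 := by simp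
  rw [Finset.sum_congr rfl fun rc _ ↦ sum_polyOf (Q + 1) fun a ↦
      if (polyOf rc).Monic ∧ a.degree < (polyOf rc).degree ∧ IsCoprime a (polyOf rc) then
        psi e (toK a * toK n / toK (polyOf rc)) *
          ((hFun (toK (polyOf rc) / tK ^ Q) (toK n / tK ^ (2 * Q)) : ℝ) : ℂ)
      else 0,
    sum_polyOf (Q + 1) fun r ↦ ∑ a ∈ polysLT Fq (Q + 1),
      if r.Monic ∧ a.degree < r.degree ∧ IsCoprime a r then
        psi e (toK a * toK n / toK r) *
          ((hFun (toK r / tK ^ Q) (toK n / tK ^ (2 * Q)) : ℝ) : ℂ)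
      else 0,
    sum_monic_coprime]
  have hterm : ∀ j ∈ Finset.range (Q + 1),
      ∑ r ∈ monicsOfDegree Fq j, ∑ a ∈ coprimeLT j r, psi e (toK a * toK n / toK r) *
          ((hFun (toK r / tK ^ Q) (toK n / tK ^ (2 * Q)) : ℝ) : ℂ) =
        (Fintype.card Fq : ℂ) ^ Q * if n.degree < (j + Q : ℕ) then
          ramanujanSum e n j / (Fintype.card Fq : ℂ) ^ j else 0 := by
    intro j _
    trans ramanujanSum e n j * if n.degree < (j + Q : ℕ) then
      (Fintype.card Fq : ℂ) ^ Q / (Fintype.card Fq : ℂ) ^ j else 0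
    · rw [ramanujanSum, Finset.sum_mul]
      refine Finset.sum_congr rfl fun r hr ↦ ?_
      obtain ⟨hm, rfl⟩ := mem_monicsOfDegree.1 hr
      rw [Finset.sum_mul, hFun_toK hm.ne_zero]
      congr! 2
      split_ifs <;> simp
    · split_ifs <;> ring
  rw [Finset.sum_congr rfl hterm, ← Finset.mul_sum, sum_ramanujanSum_ite he]
  split_ifs
  · field_simp
    ring
  · simp
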